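/- Outer bound for the all-or-nothing access structure (Theorem 4): every achievable rate tuple (R_d)_{d∈𝒟} ∈ C(𝔸*) satisfies, for every subset S ⊆ 𝒟, Σ_{d∈S} R_d ≤ min_{T⊊ℒ} I(Y_S; X_ℒ, Y_{S^c} | X_T), the minimum being over all strict subsets T of ℒ (including T = ∅). -/

import Mathlib

open scoped BigOperators
open Finset Filter

noncomputable section

namespace SecretSharing

open scoped Classical

/-! ### Basic Shannon information quantities (base 2) on finite probability spaces -/

variable {Ω : Type*} [Fintype Ω]

/-- `p` is a probability mass function on the finite type `Ω`. -/
def IsPMF (p : Ω → ℝ) : Prop := (∀ ω, 0 ≤ p ω) ∧ ∑ ω : Ω, p ω = 1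

/-- Probability that the random variable `X` takes the value `a` under `p`. -/
def prob (p : Ω → ℝ) {A : Type*} (X : Ω → A) (a : A) : ℝ :=
  ∑ ω : Ω, if X ω = a then p ω else 0

/-- Shannon entropy (in bits) of the random variable `X` under `p`. -/
def ent (p : Ω → ℝ) {A : Type*} [Fintype A] (X : Ω → A) : ℝ :=
  -∑ a : A, prob p X a * Real.logb 2 (prob p X a)

/-- Conditional Shannon entropy `H(X | Y)` in bits. -/
def condEnt (p : Ω → ℝ) {A B : Type*} [Fintype A] [Fintype B]
    (X : Ω → A) (Y : Ω → B) : ℝ :=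
  ent p (fun ω => (X ω, Y ω)) - ent p Y

/-- Mutual information `I(X ; Y)` in bits. -/
def mutInf (p : Ω → ℝ) {A B : Type*} [Fintype A] [Fintype B]
    (X : Ω → A) (Y : Ω → B) : ℝ :=
  ent p X + ent p Y - ent p (fun ω => (X ω, Y ω))

/-- Conditional mutual information `I(X ; Y | Z)` in bits. -/
def condMutInf (p : Ω → ℝ) {A B C : Type*} [Fintype A] [Fintype B] [Fintype C]
    (X : Ω → A) (Y : Ω → B) (Z : Ω → C) : ℝ :=
  condEnt p X Z - condEnt p X (fun ω => (Y ω, Z ω))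

/-! ### The distributed secret-sharing model -/

variable {L D : ℕ} {𝒳 : Fin L → Type} {𝒴 : Fin D → Type}
variable [∀ l, Fintype (𝒳 l)] [∀ d, Fintype (𝒴 d)]

/-- Sample space for one source symbol: the participants' observations and the
sub-dealers' observations. -/
abbrev Base (𝒳 : Fin L → Type) (𝒴 : Fin D → Type) : Type := (∀ l, 𝒳 l) × (∀ d, 𝒴 d)

/-- The i.i.d. product pmf of `p` over `n` source symbols. -/
def iid (p : Base 𝒳 𝒴 → ℝ) (n : ℕ) : (Fin n → Base 𝒳 𝒴) → ℝ :=
  fun ω => ∏ i, p (ω i)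

/-- Observations `X_T` of the set `T` of participants (single symbol). -/
def XT (T : Finset (Fin L)) : Base 𝒳 𝒴 → ∀ l : {l // l ∈ T}, 𝒳 l.1 :=
  fun ω l => ω.1 l.1

/-- Observations `Y_S` of the set `S` of sub-dealers (single symbol). -/
def YS (S : Finset (Fin D)) : Base 𝒳 𝒴 → ∀ d : {d // d ∈ S}, 𝒴 d.1 :=
  fun ω d => ω.2 d.1

/-- Observations `X_T^n` of the set `T` of participants over a block of length `n`. -/
def XTn (T : Finset (Fin L)) (n : ℕ) :
    (Fin n → Base 𝒳 𝒴) → ∀ l : {l // l ∈ T}, Fin n → 𝒳 l.1 :=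
  fun ω l i => (ω i).1 l.1

/-- Cardinality `⌈2^{n R_d}⌉` of the secret alphabet of sub-dealer `d`. -/
def secCard (R : Fin D → ℝ) (n : ℕ) (d : Fin D) : ℕ := ⌈(2:ℝ) ^ ((n : ℝ) * R d)⌉₊

/-- A secret-sharing strategy at blocklength `n` with rates `R`, for the access
structure `𝔸`: public messages, secrets, and decoders for authorized sets. -/
structure Strategy (𝒳 : Fin L → Type) (𝒴 : Fin D → Type)
    (𝔸 : Set (Finset (Fin L))) (R : Fin D → ℝ) (n : ℕ) where
  msgCard : Fin D → ℕ
  encM : ∀ d : Fin D, (Fin n → 𝒴 d) → Fin (msgCard d)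
  encS : ∀ d : Fin D, (Fin n → 𝒴 d) → Fin (secCard R n d)
  dec : ∀ A : Finset (Fin L), A ∈ 𝔸 →
    (∀ l : {l // l ∈ A}, Fin n → 𝒳 l.1) → (∀ d, Fin (msgCard d)) →
      ∀ d, Fin (secCard R n d)

variable {𝔸 : Set (Finset (Fin L))} {R : Fin D → ℝ} {n : ℕ}

/-- The public communication `M_𝒟` as a random variable. -/
def Strategy.Mrv (σ : Strategy 𝒳 𝒴 𝔸 R n) :
    (Fin n → Base 𝒳 𝒴) → ∀ d, Fin (σ.msgCard d) :=
  fun ω d => σ.encM d (fun i => (ω i).2 d)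

/-- The secrets `S_𝒟` as a random variable. -/
def Strategy.Srv (σ : Strategy 𝒳 𝒴 𝔸 R n) :
    (Fin n → Base 𝒳 𝒴) → ∀ d, Fin (secCard R n d) :=
  fun ω d => σ.encS d (fun i => (ω i).2 d)

/-- The estimate `Ŝ_𝒟(A)` computed by the authorized set `A`. -/
def Strategy.ShatRv (σ : Strategy 𝒳 𝒴 𝔸 R n) (A : Finset (Fin L)) (hA : A ∈ 𝔸) :
    (Fin n → Base 𝒳 𝒴) → ∀ d, Fin (secCard R n d) :=
  fun ω => σ.dec A hA (fun l i => (ω i).1 l.1) (σ.Mrv ω)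

/-- Error probability `P[Ŝ_𝒟(A) ≠ S_𝒟]`. -/
def Strategy.err (p : Base 𝒳 𝒴 → ℝ) (σ : Strategy 𝒳 𝒴 𝔸 R n)
    (A : Finset (Fin L)) (hA : A ∈ 𝔸) : ℝ :=
  ∑ ω : Fin n → Base 𝒳 𝒴, if σ.ShatRv A hA ω ≠ σ.Srv ω then iid p n ω else 0

/-- Information leakage `I(S_𝒟 ; M_𝒟, X_U^n)` to the set `U` of participants. -/
def Strategy.leak (p : Base 𝒳 𝒴 → ℝ) (σ : Strategy 𝒳 𝒴 𝔸 R n)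
    (U : Finset (Fin L)) : ℝ :=
  mutInf (iid p n) σ.Srv (fun ω => (σ.Mrv ω, XTn U n ω))

/-- Uniformity defect `log₂|𝒮_𝒟| - H(S_𝒟)`. -/
def Strategy.unif (p : Base 𝒳 𝒴 → ℝ) (σ : Strategy 𝒳 𝒴 𝔸 R n) : ℝ :=
  Real.logb 2 (∏ d, (secCard R n d : ℝ)) - ent (iid p n) σ.Srv

/-- Achievability of the rate tuple `R` for access structure `𝔸` and
unauthorized sets `𝕌`: a sequence of strategies with vanishing error
probability (for every authorized set), vanishing leakage (for every
unauthorized set), and vanishing uniformity defect. -/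
def Achievable (p : Base 𝒳 𝒴 → ℝ) (𝔸 𝕌 : Set (Finset (Fin L)))
    (R : Fin D → ℝ) : Prop :=
  (∀ d, 0 ≤ R d) ∧
  ∃ σ : (n : ℕ) → Strategy 𝒳 𝒴 𝔸 R n,
    (∀ A : Finset (Fin L), ∀ hA : A ∈ 𝔸,
      Tendsto (fun n => (σ n).err p A hA) atTop (nhds 0)) ∧
    (∀ U ∈ 𝕌, Tendsto (fun n => (σ n).leak p U) atTop (nhds 0)) ∧
    Tendsto (fun n => (σ n).unif p) atTop (nhds 0)

/-- `𝔸` is a monotone access structure: nonempty, not containing `∅`, and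
closed under taking supersets. -/
def MonotoneAccess (𝔸 : Set (Finset (Fin L))) : Prop :=
  𝔸.Nonempty ∧ ∅ ∉ 𝔸 ∧ ∀ A ∈ 𝔸, ∀ T : Finset (Fin L), A ⊆ T → T ∈ 𝔸


/-! ### Auxiliary entropy calculus -/

section Aux

universe u v

/-- `X` determines `Y`. -/
def Det {Ω : Type*} {A B : Type*} (X : Ω → A) (Y : Ω → B) : Prop :=
  ∀ ω ω', X ω = X ω' → Y ω = Y ω'

lemma prob_nonneg {Ω : Type*} [Fintype Ω] {p : Ω → ℝ} (hp : IsPMF p) {A : Type*}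
    (X : Ω → A) (a : A) : 0 ≤ prob p X a := by
  unfold prob
  refine Finset.sum_nonneg fun ω _ => ?_
  split_ifs
  · exact hp.1 ω
  · exact le_rfl

lemma le_prob {Ω : Type*} [Fintype Ω] {p : Ω → ℝ} (hp : IsPMF p) {A : Type*}
    (X : Ω → A) (ω : Ω) : p ω ≤ prob p X (X ω) := by
  unfold prob
  have := Finset.single_le_sum (f := fun ω' => if X ω' = X ω then p ω' else 0)
    (s := Finset.univ) (fun ω' _ => by
      show (0:ℝ) ≤ if X ω' = X ω then p ω' else 0
      split_ifs
      · exact hp.1 ω'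
      · exact le_rfl) (Finset.mem_univ ω)
  simpa using this

/-- Pushforward of expectation. -/
lemma sum_prob_mul {Ω : Type*} [Fintype Ω] (p : Ω → ℝ) {A : Type*} [Fintype A]
    (X : Ω → A) (f : A → ℝ) : ∑ a, prob p X a * f a = ∑ ω, p ω * f (X ω) := by
  unfold prob
  simp_rw [Finset.sum_mul]
  rw [Finset.sum_comm]
  refine Finset.sum_congr rfl fun ω _ => ?_
  simp [ite_mul]

lemma sum_prob {Ω : Type*} [Fintype Ω] {p : Ω → ℝ} (hp : IsPMF p) {A : Type*} [Fintype A]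
    (X : Ω → A) : ∑ a, prob p X a = 1 := by
  have := sum_prob_mul p X (fun _ => 1)
  simpa [hp.2] using this

lemma ent_eq {Ω : Type*} [Fintype Ω] (p : Ω → ℝ) {A : Type*} [Fintype A]
    (X : Ω → A) : ent p X = -∑ ω, p ω * Real.logb 2 (prob p X (X ω)) := by
  unfold ent
  rw [sum_prob_mul p X (fun a => Real.logb 2 (prob p X a))]

lemma prob_mono {Ω : Type*} [Fintype Ω] {p : Ω → ℝ} (hp : IsPMF p) {A B : Type*}
    (X : Ω → A) (Y : Ω → B) (h : Det X Y) (ω : Ω) :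
    prob p X (X ω) ≤ prob p Y (Y ω) := by
  unfold prob
  refine Finset.sum_le_sum fun ω' _ => ?_
  by_cases h1 : X ω' = X ω
  · simp [h1, h _ _ h1]
  · simp only [h1, if_false]
    split_ifs
    · exact hp.1 ω'
    · exact le_rfl

lemma ent_mono {Ω : Type*} [Fintype Ω] {p : Ω → ℝ} (hp : IsPMF p) {A B : Type*}
    [Fintype A] [Fintype B]
    (X : Ω → A) (Y : Ω → B) (h : Det X Y) : ent p Y ≤ ent p X := by
  rw [ent_eq, ent_eq]
  refine neg_le_neg (Finset.sum_le_sum fun ω _ => ?_)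
  rcases (hp.1 ω).eq_or_lt with h0 | h0
  · simp [← h0]
  · refine mul_le_mul_of_nonneg_left ?_ h0.le
    exact Real.logb_le_logb_of_le (by norm_num) (h0.trans_le (le_prob hp X ω))
      (prob_mono hp X Y h ω)

lemma ent_congr {Ω : Type*} [Fintype Ω] {p : Ω → ℝ} (hp : IsPMF p) {A B : Type*}
    [Fintype A] [Fintype B]
    (X : Ω → A) (Y : Ω → B) (h : Det X Y) (h' : Det Y X) : ent p X = ent p Y :=
  le_antisymm (ent_mono hp Y X h') (ent_mono hp X Y h)

/-- Gibbs' inequality. -/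
lemma gibbs {Ω : Type*} [Fintype Ω] {p : Ω → ℝ} (hp : IsPMF p) {A : Type*}
    [Fintype A] (X : Ω → A) (q : A → ℝ) (hq : ∀ a, 0 ≤ q a) (hq1 : ∑ a, q a ≤ 1)
    (hpos : ∀ ω, 0 < p ω → 0 < q (X ω)) :
    ent p X ≤ -∑ ω, p ω * Real.logb 2 (q (X ω)) := by
  rw [ent_eq]
  have key : ∑ ω, p ω * (q (X ω) / prob p X (X ω)) ≤ 1 := by
    rw [← sum_prob_mul p X (fun a => q a / prob p X a)]
    refine le_trans (Finset.sum_le_sum fun a _ => ?_) hq1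
    rcases (prob_nonneg hp X a).eq_or_lt with h0 | h0
    · simp [← h0, hq a]
    · rw [mul_div_cancel₀ _ h0.ne']
  have hl : 0 < Real.log 2 := Real.log_pos (by norm_num)
  have h2 : ∑ ω, p ω * (Real.log (q (X ω)) - Real.log (prob p X (X ω))) ≤ 0 := by
    have : ∑ ω, p ω * (Real.log (q (X ω)) - Real.log (prob p X (X ω)))
        ≤ ∑ ω, (p ω * (q (X ω) / prob p X (X ω)) - p ω) := by
      refine Finset.sum_le_sum fun ω _ => ?_
      rcases (hp.1 ω).eq_or_lt with h0 | h0
      · simp [← h0]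
      · have hP := h0.trans_le (le_prob hp X ω)
        have hQ := hpos ω h0
        rw [← Real.log_div hQ.ne' hP.ne']
        have := Real.log_le_sub_one_of_pos (div_pos hQ hP)
        nlinarith
    rw [Finset.sum_sub_distrib, hp.2] at this
    linarith
  have h3 : ∑ ω, p ω * Real.logb 2 (q (X ω)) - ∑ ω, p ω * Real.logb 2 (prob p X (X ω))
      = (∑ ω, p ω * (Real.log (q (X ω)) - Real.log (prob p X (X ω)))) / Real.log 2 := by
    rw [← Finset.sum_sub_distrib, Finset.sum_div]
    refine Finset.sum_congr rfl fun ω _ => ?_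
    simp only [Real.logb]
    ring
  have h4 := div_nonpos_of_nonpos_of_nonneg h2 hl.le
  linarith

lemma ent_le_log_card {Ω : Type*} [Fintype Ω] {p : Ω → ℝ} (hp : IsPMF p) {A : Type*}
    [Fintype A] [Nonempty A] (X : Ω → A) :
    ent p X ≤ Real.logb 2 (Fintype.card A) := by
  have hc : (0:ℝ) < Fintype.card A := by exact_mod_cast Fintype.card_pos
  have := gibbs hp X (fun _ => (Fintype.card A : ℝ)⁻¹) (fun _ => by positivity)
    (by simp [hc.ne']) (fun _ _ => by positivity)
  refine this.trans (le_of_eq ?_)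
  rw [← Finset.sum_mul, hp.2, Real.logb_inv]
  ring

/-- The marginal sums. -/
lemma sum_prob_pair {Ω : Type*} [Fintype Ω] (p : Ω → ℝ) {A C : Type*}
    [Fintype A] (X : Ω → A) (Z : Ω → C) (c : C) :
    ∑ a, prob p (fun ω => (X ω, Z ω)) (a, c) = prob p Z c := by
  unfold prob
  rw [Finset.sum_comm]
  refine Finset.sum_congr rfl fun ω _ => ?_
  by_cases h : Z ω = c <;> simp [h]

lemma submod {Ω : Type*} [Fintype Ω] {p : Ω → ℝ} (hp : IsPMF p) {A B C : Type*}
    [Fintype A] [Fintype B] [Fintype C] (X : Ω → A) (Y : Ω → B) (Z : Ω → C) :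
    ent p (fun ω => (X ω, Y ω, Z ω)) + ent p Z
      ≤ ent p (fun ω => (X ω, Z ω)) + ent p (fun ω => (Y ω, Z ω)) := by
  have hg := gibbs hp (fun ω => (X ω, Y ω, Z ω))
    (fun t => prob p (fun ω => (X ω, Z ω)) (t.1, t.2.2)
      * prob p (fun ω => (Y ω, Z ω)) (t.2.1, t.2.2) / prob p Z t.2.2)
    (fun t => div_nonneg (mul_nonneg (prob_nonneg hp _ _) (prob_nonneg hp _ _))
      (prob_nonneg hp _ _))
    (by
      rw [Fintype.sum_prod_type, Finset.sum_comm, Fintype.sum_prod_type, Finset.sum_comm]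
      have : ∀ c : C, (∑ b : B, ∑ a : A, prob p (fun ω => (X ω, Z ω)) (a, c)
          * prob p (fun ω => (Y ω, Z ω)) (b, c) / prob p Z c) = prob p Z c := by
        intro c
        simp_rw [← Finset.sum_div, ← Finset.sum_mul, ← Finset.mul_sum, sum_prob_pair]
        exact mul_self_div_self _
      simp only [this]
      exact (sum_prob hp Z).le)
    (fun ω h0 => div_pos (mul_pos (h0.trans_le (le_prob hp (fun ω => (X ω, Z ω)) ω))
      (h0.trans_le (le_prob hp (fun ω => (Y ω, Z ω)) ω))) (h0.trans_le (le_prob hp Z ω)))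
  have e : ∑ ω, p ω * Real.logb 2 (prob p (fun ω => (X ω, Z ω)) (X ω, Z ω)
      * prob p (fun ω => (Y ω, Z ω)) (Y ω, Z ω) / prob p Z (Z ω))
      = ∑ ω, p ω * Real.logb 2 (prob p (fun ω => (X ω, Z ω)) (X ω, Z ω))
        + ∑ ω, p ω * Real.logb 2 (prob p (fun ω => (Y ω, Z ω)) (Y ω, Z ω))
        - ∑ ω, p ω * Real.logb 2 (prob p Z (Z ω)) := by
    rw [← Finset.sum_add_distrib, ← Finset.sum_sub_distrib]
    refine Finset.sum_congr rfl fun ω _ => ?_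
    rcases (hp.1 ω).eq_or_lt with h0 | h0
    · simp [← h0]
    · have h1 := h0.trans_le (le_prob hp (fun ω => (X ω, Z ω)) ω)
      have h2 := h0.trans_le (le_prob hp (fun ω => (Y ω, Z ω)) ω)
      have h3 := h0.trans_le (le_prob hp Z ω)
      rw [Real.logb_div (mul_pos h1 h2).ne' h3.ne', Real.logb_mul h1.ne' h2.ne']
      ring
  simp only [e] at hg
  rw [ent_eq p Z, ent_eq p (fun ω => (X ω, Z ω)), ent_eq p (fun ω => (Y ω, Z ω))]
  linarith

/-- Submodularity in determination form. -/
lemma submod' {Ω : Type*} [Fintype Ω] {p : Ω → ℝ} (hp : IsPMF p) {A B C E : Type*}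
    [Fintype A] [Fintype B] [Fintype C] [Fintype E]
    (U : Ω → A) (V : Ω → B) (J : Ω → E) (I : Ω → C)
    (hJ : Det (fun ω => (U ω, V ω)) J) (hU : Det U I) (hV : Det V I) :
    ent p J + ent p I ≤ ent p U + ent p V := by
  have h := submod hp U V I
  have h1 : ent p J ≤ ent p (fun ω => (U ω, V ω, I ω)) :=
    ent_mono hp _ _ (fun ω ω' h => hJ ω ω' (by simp only [Prod.mk.injEq] at h ⊢; tauto))
  have h2 : ent p (fun ω => (U ω, I ω)) ≤ ent p U :=
    ent_mono hp _ _ (fun ω ω' h => by simp [h, hU ω ω' h])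
  have h3 : ent p (fun ω => (V ω, I ω)) ≤ ent p V :=
    ent_mono hp _ _ (fun ω ω' h => by simp [h, hV ω ω' h])
  linarith

lemma ent_unit {Ω : Type*} [Fintype Ω] {p : Ω → ℝ} (hp : IsPMF p) :
    ent p (fun _ : Ω => ()) = 0 := by
  rw [ent_eq]
  simp [prob, hp.2]

lemma fano {Ω : Type*} [Fintype Ω] {p : Ω → ℝ} (hp : IsPMF p) {A : Type*}
    [Fintype A] [Nonempty A] (X Z : Ω → A) :
    ent p (fun ω => (X ω, Z ω)) ≤ ent p Z + 1
      + (∑ ω, if Z ω ≠ X ω then p ω else 0) * Real.logb 2 (Fintype.card A) := by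
  have hc : (0:ℝ) < Fintype.card A := by exact_mod_cast Fintype.card_pos
  have hw : ∀ a b : A, (0:ℝ) < (if b ≠ a then (2 * (Fintype.card A : ℝ))⁻¹ else 2⁻¹) := by
    intro a b
    split_ifs <;> positivity
  have hg := gibbs hp (fun ω => (X ω, Z ω))
    (fun t => prob p Z t.2 * (if t.2 ≠ t.1 then (2 * (Fintype.card A : ℝ))⁻¹ else 2⁻¹))
    (fun t => mul_nonneg (prob_nonneg hp _ _) (hw _ _).le)
    (by
      rw [Fintype.sum_prod_type, Finset.sum_comm]
      simp only []
      calc ∑ b : A, ∑ a : A, prob p Z b *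
            (if b ≠ a then (2 * (Fintype.card A : ℝ))⁻¹ else 2⁻¹)
          ≤ ∑ b : A, prob p Z b * 1 := by
            refine Finset.sum_le_sum fun b _ => ?_
            rw [← Finset.mul_sum]
            refine mul_le_mul_of_nonneg_left ?_ (prob_nonneg hp _ _)
            calc ∑ a : A, (if b ≠ a then (2 * (Fintype.card A : ℝ))⁻¹ else 2⁻¹)
                ≤ ∑ a : A, ((2 * (Fintype.card A : ℝ))⁻¹ + if b = a then 2⁻¹ else 0) := by
                  refine Finset.sum_le_sum fun a _ => ?_
                  by_cases h : b = a
                  · simp only [h, ne_eq, not_true_eq_false, if_false, if_true]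
                    have : (0:ℝ) < (2 * (Fintype.card A : ℝ))⁻¹ := by positivity
                    linarith
                  · simp [h]
              _ = 1 := by
                  rw [Finset.sum_add_distrib]
                  simp
                  field_simp
                  norm_num
        _ = 1 := by simp [sum_prob hp Z])
    (fun ω h0 => mul_pos (h0.trans_le (le_prob hp Z ω)) (hw _ _))
  refine hg.trans (le_of_eq ?_)
  rw [ent_eq p Z]
  have e : ∀ ω, p ω * Real.logb 2 (prob p Z (Z ω) *
        (if Z ω ≠ X ω then (2 * (Fintype.card A : ℝ))⁻¹ else 2⁻¹))
      = p ω * Real.logb 2 (prob p Z (Z ω)) - p ω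
        - (if Z ω ≠ X ω then p ω else 0) * Real.logb 2 (Fintype.card A) := by
    intro ω
    rcases (hp.1 ω).eq_or_lt with h0 | h0
    · simp [← h0]
    · have h3 := h0.trans_le (le_prob hp Z ω)
      rw [Real.logb_mul h3.ne' (hw _ _).ne']
      by_cases h : Z ω = X ω
      · simp [h, Real.logb_inv]
        ring
      · simp only [ne_eq, h, not_false_eq_true, if_true]
        rw [Real.logb_inv, Real.logb_mul (by norm_num) hc.ne']
        simp
        ring
  simp only [e]
  rw [Finset.sum_sub_distrib, Finset.sum_sub_distrib, hp.2, ← Finset.sum_mul]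
  ring

/-- The information-theoretic core of the converse. -/
lemma converse_core {Ω : Type*} [Fintype Ω] {p : Ω → ℝ} (hp : IsPMF p)
    {tA tA' tD tM tMS tT tL tY tW : Type*}
    [Fintype tA] [Fintype tA'] [Fintype tD] [Nonempty tD] [Fintype tM] [Fintype tMS]
    [Fintype tT] [Fintype tL] [Fintype tY] [Fintype tW] [Nonempty tA']
    (A : Ω → tA) (A' : Ω → tA') (SD Sh : Ω → tD) (M : Ω → tM) (MS : Ω → tMS)
    (T : Ω → tT) (X : Ω → tL) (Y : Ω → tY) (W : Ω → tW)
    (hAY : Det Y A) (hMSY : Det Y MS) (hMM : Det M MS)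
    (hM : Det (fun ω => (MS ω, W ω)) M) (hAS : Det SD A)
    (hS : Det (fun ω => (A ω, A' ω)) SD) (hSh : Det (fun ω => (M ω, X ω)) Sh)
    (hT : Det X T) (ε : ℝ) (hε : (∑ ω, if Sh ω ≠ SD ω then p ω else 0) = ε) :
    ent p SD ≤ Real.logb 2 (Fintype.card tA')
      + mutInf p SD (fun ω => (M ω, T ω))
      + (1 + ε * Real.logb 2 (Fintype.card tD))
      + condMutInf p Y (fun ω => (X ω, W ω)) T := by
  have h0 := ent_le_log_card hp A'
  have h1 := submod' hp A A' SD (fun _ => ()) hS (fun _ _ _ => rfl) (fun _ _ _ => rfl)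
  rw [ent_unit hp] at h1
  have h2 := submod' hp SD (fun ω => (A ω, (M ω, T ω))) (fun ω => (SD ω, (M ω, T ω))) A
    (by intro ω ω' h; simp only [Prod.mk.injEq] at h ⊢; tauto) hAS
    (by intro ω ω' h; simp only [Prod.mk.injEq] at h ⊢; tauto)
  have h3 := fano hp SD Sh
  rw [hε] at h3
  have h4 := submod' hp (fun ω => (SD ω, Sh ω)) (fun ω => (M ω, X ω))
    (fun ω => (A ω, (M ω, X ω))) Sh
    (by intro ω ω' h; have := hAS ω ω'; simp only [Prod.mk.injEq] at h ⊢; tauto)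
    (by intro ω ω' h; simp only [Prod.mk.injEq] at h ⊢; tauto) hSh
  have h5 := submod' hp (fun ω => (A ω, (M ω, X ω))) (fun ω => (MS ω, (X ω, W ω)))
    (fun ω => (A ω, (MS ω, (X ω, W ω)))) (fun ω => (M ω, X ω))
    (by intro ω ω' h; simp only [Prod.mk.injEq] at h ⊢; tauto)
    (by intro ω ω' h; simp only [Prod.mk.injEq] at h ⊢; tauto)
    (by intro ω ω' h; have := hM ω ω'; simp only [Prod.mk.injEq] at h this ⊢; tauto)
  have h6 := submod' hp (fun ω => (A ω, (MS ω, T ω))) (fun ω => (M ω, T ω))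
    (fun ω => (A ω, (M ω, T ω))) (fun ω => (MS ω, T ω))
    (by intro ω ω' h; simp only [Prod.mk.injEq] at h ⊢; tauto)
    (by intro ω ω' h; simp only [Prod.mk.injEq] at h ⊢; tauto)
    (by intro ω ω' h; have := hMM ω ω'; simp only [Prod.mk.injEq] at h this ⊢; tauto)
  have h7 := submod' hp (fun ω => (MS ω, T ω)) (fun ω => ((X ω, W ω), T ω))
    (fun ω => (MS ω, (X ω, W ω))) T
    (by intro ω ω' h; simp only [Prod.mk.injEq] at h ⊢; tauto)
    (by intro ω ω' h; simp only [Prod.mk.injEq] at h ⊢; tauto)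
    (by intro ω ω' h; simp only [Prod.mk.injEq] at h ⊢; tauto)
  have h8 := submod' hp (fun ω => (Y ω, T ω)) (fun ω => (A ω, (MS ω, (X ω, W ω))))
    (fun ω => (Y ω, ((X ω, W ω), T ω))) (fun ω => (A ω, (MS ω, T ω)))
    (by intro ω ω' h; have := hT ω ω'; simp only [Prod.mk.injEq] at h ⊢; tauto)
    (by intro ω ω' h; have := hAY ω ω'; have := hMSY ω ω'
        simp only [Prod.mk.injEq] at h ⊢; tauto)
    (by intro ω ω' h; have := hT ω ω'; simp only [Prod.mk.injEq] at h ⊢; tauto)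
  unfold mutInf condMutInf condEnt
  linarith

/-! ### I.i.d. sources -/

lemma iid_isPMF {L D : ℕ} {𝒳 : Fin L → Type} {𝒴 : Fin D → Type}
    [∀ l, Fintype (𝒳 l)] [∀ d, Fintype (𝒴 d)] {p : Base 𝒳 𝒴 → ℝ} (hp : IsPMF p) (n : ℕ) :
    IsPMF (iid p n) := by
  refine ⟨fun ω => Finset.prod_nonneg fun i _ => hp.1 _, ?_⟩
  unfold iid
  rw [← Fintype.prod_sum (fun (_ : Fin n) ω => p ω)]
  simp [hp.2]

lemma iid_prob {L D : ℕ} {𝒳 : Fin L → Type} {𝒴 : Fin D → Type}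
    [∀ l, Fintype (𝒳 l)] [∀ d, Fintype (𝒴 d)] (p : Base 𝒳 𝒴 → ℝ) (n : ℕ)
    {A : Type*} (X : Base 𝒳 𝒴 → A) (a : Fin n → A) :
    prob (iid p n) (fun ω i => X (ω i)) a = ∏ i, prob p X (a i) := by
  unfold prob iid
  rw [Fintype.prod_sum (fun (i : Fin n) ω => if X ω = a i then p ω else 0)]
  refine Finset.sum_congr rfl fun ω _ => ?_
  by_cases h : (fun i => X (ω i)) = a
  · have h' : ∀ i, X (ω i) = a i := fun i => congrFun h i
    simp [h']
  · rw [if_neg h]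
    obtain ⟨i, hi⟩ := Function.ne_iff.mp h
    symm
    exact Finset.prod_eq_zero (Finset.mem_univ i) (by simp [hi])

lemma iid_sum_coord {L D : ℕ} {𝒳 : Fin L → Type} {𝒴 : Fin D → Type}
    [∀ l, Fintype (𝒳 l)] [∀ d, Fintype (𝒴 d)] {p : Base 𝒳 𝒴 → ℝ} (hp : IsPMF p) (n : ℕ)
    (f : Base 𝒳 𝒴 → ℝ) (j : Fin n) :
    ∑ ω, iid p n ω * f (ω j) = ∑ b, p b * f b := by
  have h1 : ∀ ω : Fin n → Base 𝒳 𝒴, iid p n ω * f (ω j)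
      = ∏ i, (p (ω i) * if i = j then f (ω i) else 1) := by
    intro ω
    rw [Finset.prod_mul_distrib]
    simp [iid]
  simp only [h1]
  rw [← Fintype.prod_sum (fun (i : Fin n) b => p b * if i = j then f b else 1)]
  rw [Finset.prod_eq_single j]
  · simp
  · intro i _ hi
    simp [hi, hp.2]
  · simp

lemma iid_ent {L D : ℕ} {𝒳 : Fin L → Type} {𝒴 : Fin D → Type}
    [∀ l, Fintype (𝒳 l)] [∀ d, Fintype (𝒴 d)] {p : Base 𝒳 𝒴 → ℝ} (hp : IsPMF p) (n : ℕ)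
    {A : Type*} [Fintype A] (X : Base 𝒳 𝒴 → A) :
    ent (iid p n) (fun ω i => X (ω i)) = n * ent p X := by
  rw [ent_eq, ent_eq]
  have h1 : ∀ ω : Fin n → Base 𝒳 𝒴,
      iid p n ω * Real.logb 2 (prob (iid p n) (fun ω i => X (ω i)) (fun i => X (ω i)))
      = ∑ j, iid p n ω * Real.logb 2 (prob p X (X (ω j))) := by
    intro ω
    rw [iid_prob, ← Finset.mul_sum]
    rcases ((iid_isPMF hp n).1 ω).eq_or_lt with h0 | h0
    · simp [← h0]
    · congr 1
      refine Real.logb_prod _ _ fun i _ => ?_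
      have : p (ω i) ≠ 0 := fun h => h0.ne' (Finset.prod_eq_zero (Finset.mem_univ i) h)
      exact (lt_of_lt_of_le (lt_of_le_of_ne (hp.1 _) this.symm) (le_prob hp X (ω i))).ne'
  simp only [h1]
  rw [Finset.sum_comm]
  simp only [iid_sum_coord hp n (fun b => Real.logb 2 (prob p X (X b)))]
  simp

/-- Block version of `Y_S`. -/
def YSn {L D : ℕ} {𝒳 : Fin L → Type} {𝒴 : Fin D → Type} (S : Finset (Fin D)) (n : ℕ) :
    (Fin n → Base 𝒳 𝒴) → ∀ d : {d // d ∈ S}, Fin n → 𝒴 d.1 :=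
  fun ω d i => (ω i).2 d.1

lemma condMutInf_iid {L D : ℕ} {𝒳 : Fin L → Type} {𝒴 : Fin D → Type}
    [∀ l, Fintype (𝒳 l)] [∀ d, Fintype (𝒴 d)] {p : Base 𝒳 𝒴 → ℝ} (hp : IsPMF p) (n : ℕ)
    (S : Finset (Fin D)) (T : Finset (Fin L)) :
    condMutInf (iid p n) (YSn S n) (fun ω => (XTn Finset.univ n ω, YSn Sᶜ n ω)) (XTn T n)
      = n * condMutInf p (YS S) (fun ω => (XT Finset.univ ω, YS Sᶜ ω)) (XT T) := by
  have hq := iid_isPMF hp n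
  unfold condMutInf condEnt
  have a1 := ent_congr hq (fun ω => (YSn S n ω, XTn T n ω))
    (fun ω i => (YS S (ω i), XT T (ω i)))
    (by intro ω ω' h
        simp only [Prod.mk.injEq, funext_iff, YSn, XTn, YS, XT] at h ⊢; tauto)
    (by intro ω ω' h
        simp only [Prod.mk.injEq, funext_iff, YSn, XTn, YS, XT] at h ⊢
        exact ⟨fun d i => (h i).1 d, fun d i => (h i).2 d⟩)
  have a2 := ent_congr hq (XTn T n) (fun ω i => XT T (ω i))
    (by intro ω ω' h; simp only [funext_iff, XTn, XT] at h ⊢; tauto)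
    (by intro ω ω' h; simp only [funext_iff, XTn, XT] at h ⊢; tauto)
  have a3 := ent_congr hq
    (fun ω => ((XTn Finset.univ n ω, YSn Sᶜ n ω), XTn T n ω))
    (fun ω i => ((XT Finset.univ (ω i), YS Sᶜ (ω i)), XT T (ω i)))
    (by intro ω ω' h
        simp only [Prod.mk.injEq, funext_iff, YSn, XTn, YS, XT] at h ⊢
        exact fun i => ⟨⟨fun d => h.1.1 d i, fun d => h.1.2 d i⟩, fun d => h.2 d i⟩)
    (by intro ω ω' h
        simp only [Prod.mk.injEq, funext_iff, YSn, XTn, YS, XT] at h ⊢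
        exact ⟨⟨fun d i => (h i).1.1 d, fun d i => (h i).1.2 d⟩, fun d i => (h i).2 d⟩)
  have a4 := ent_congr hq
    (fun ω => (YSn S n ω, ((XTn Finset.univ n ω, YSn Sᶜ n ω), XTn T n ω)))
    (fun ω i => (YS S (ω i), ((XT Finset.univ (ω i), YS Sᶜ (ω i)), XT T (ω i))))
    (by intro ω ω' h
        simp only [Prod.mk.injEq, funext_iff, YSn, XTn, YS, XT] at h ⊢
        exact fun i => ⟨fun d => h.1 d i,
          ⟨fun d => h.2.1.1 d i, fun d => h.2.1.2 d i⟩, fun d => h.2.2 d i⟩)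
    (by intro ω ω' h
        simp only [Prod.mk.injEq, funext_iff, YSn, XTn, YS, XT] at h ⊢
        exact ⟨fun d i => (h i).1 d,
          ⟨fun d i => (h i).2.1.1 d, fun d i => (h i).2.1.2 d⟩, fun d i => (h i).2.2 d⟩)
  rw [a1, a2, a3, a4, iid_ent hp n (fun b => (YS S b, XT T b)), iid_ent hp n (XT T),
    iid_ent hp n (fun b => ((XT Finset.univ b, YS Sᶜ b), XT T b)),
    iid_ent hp n (fun b => (YS S b, ((XT Finset.univ b, YS Sᶜ b), XT T b)))]
  ring

lemma secCard_pos {D : ℕ} (R : Fin D → ℝ) (n : ℕ) (d : Fin D) : 0 < secCard R n d :=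
  Nat.ceil_pos.mpr (by positivity)

lemma le_log_secCard {D : ℕ} (R : Fin D → ℝ) (n : ℕ) (d : Fin D) :
    n * R d ≤ Real.logb 2 (secCard R n d) := by
  have h : (2:ℝ) ^ ((n : ℝ) * R d) ≤ secCard R n d := Nat.le_ceil _
  calc n * R d = Real.logb 2 ((2:ℝ) ^ ((n : ℝ) * R d)) := by
        rw [Real.logb_rpow (by norm_num) (by norm_num)]
    _ ≤ _ := Real.logb_le_logb_of_le (by norm_num) (by positivity) h

lemma log_secCard_le {D : ℕ} (R : Fin D → ℝ) (hR : ∀ d, 0 ≤ R d) (n : ℕ) (d : Fin D) :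
    Real.logb 2 (secCard R n d) ≤ n * R d + 1 := by
  have h1 : (1:ℝ) ≤ (2:ℝ) ^ ((n : ℝ) * R d) :=
    Real.one_le_rpow (by norm_num) (mul_nonneg (Nat.cast_nonneg n) (hR d))
  have h : (secCard R n d : ℝ) < (2:ℝ) ^ ((n : ℝ) * R d) + 1 :=
    Nat.ceil_lt_add_one (by positivity)
  have h2 : (secCard R n d : ℝ) ≤ (2:ℝ) ^ ((n : ℝ) * R d + 1) := by
    rw [Real.rpow_add (by norm_num), Real.rpow_one]
    linarith
  calc Real.logb 2 (secCard R n d) ≤ Real.logb 2 ((2:ℝ) ^ ((n : ℝ) * R d + 1)) :=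
        Real.logb_le_logb_of_le (by norm_num) (by exact_mod_cast secCard_pos R n d) h2
    _ = _ := by rw [Real.logb_rpow (by norm_num) (by norm_num)]

lemma strategy_bound {L D : ℕ} {𝒳 : Fin L → Type} {𝒴 : Fin D → Type}
    [∀ l, Fintype (𝒳 l)] [∀ d, Fintype (𝒴 d)] {p : Base 𝒳 𝒴 → ℝ} (hp : IsPMF p)
    (R : Fin D → ℝ) (hR : ∀ d, 0 ≤ R d) (n : ℕ)
    (σ : Strategy 𝒳 𝒴 {Finset.univ} R n) (S : Finset (Fin D)) (T : Finset (Fin L)) :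
    n * ∑ d ∈ S, R d ≤ σ.unif p + σ.leak p T
      + (1 + σ.err p Finset.univ (Set.mem_singleton _) * (n * ∑ d, R d + D))
      + n * condMutInf p (YS S) (fun ω => (XT Finset.univ ω, YS Sᶜ ω)) (XT T) := by
  have hq := iid_isPMF hp n
  have : ∀ d, Nonempty (Fin (secCard R n d)) := fun d => ⟨⟨0, secCard_pos R n d⟩⟩
  have hc := converse_core hq
    (fun ω (d : {d // d ∈ S}) => σ.Srv ω d.1)
    (fun ω (d : {d // d ∈ Sᶜ}) => σ.Srv ω d.1)
    σ.Srv (σ.ShatRv Finset.univ (Set.mem_singleton _)) σ.Mrv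
    (fun ω (d : {d // d ∈ S}) => σ.Mrv ω d.1)
    (XTn T n) (XTn Finset.univ n) (YSn S n) (YSn Sᶜ n)
    (by intro ω ω' h
        funext d
        exact congrArg (σ.encS d.1) (congrFun h d))
    (by intro ω ω' h
        funext d
        exact congrArg (σ.encM d.1) (congrFun h d))
    (by intro ω ω' h
        funext d
        exact congrFun h d.1)
    (by intro ω ω' h
        simp only [Prod.mk.injEq] at h
        funext d
        by_cases hd : d ∈ S
        · exact congrFun h.1 ⟨d, hd⟩
        · exact congrArg (σ.encM d) (congrFun h.2 ⟨d, Finset.mem_compl.mpr hd⟩))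
    (by intro ω ω' h
        funext d
        exact congrFun h d.1)
    (by intro ω ω' h
        simp only [Prod.mk.injEq] at h
        funext d
        by_cases hd : d ∈ S
        · exact congrFun h.1 ⟨d, hd⟩
        · exact congrFun h.2 ⟨d, Finset.mem_compl.mpr hd⟩)
    (by intro ω ω' h
        simp only [Prod.mk.injEq] at h
        exact congrArg₂ (σ.dec Finset.univ (Set.mem_singleton _)) h.2 h.1)
    (by intro ω ω' h
        funext l
        exact congrFun h ⟨l.1, Finset.mem_univ _⟩)
    (σ.err p Finset.univ (Set.mem_singleton _)) (by unfold Strategy.err; congr!)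
  rw [condMutInf_iid hp] at hc
  have hne : ∀ d, (secCard R n d : ℝ) ≠ 0 := fun d => by exact_mod_cast (secCard_pos R n d).ne'
  have c1 : Real.logb 2 (Fintype.card (∀ d : {d // d ∈ Sᶜ}, Fin (secCard R n d.1)))
      = ∑ d ∈ Sᶜ, Real.logb 2 (secCard R n d) := by
    rw [Fintype.card_pi]
    push_cast
    rw [Real.logb_prod _ _ (fun d _ => by simpa using hne d.1)]
    simp only [Fintype.card_fin]
    exact Finset.sum_coe_sort Sᶜ (fun d => Real.logb 2 (secCard R n d : ℝ))
  have c2 : Real.logb 2 (Fintype.card (∀ d, Fin (secCard R n d)))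
      = ∑ d, Real.logb 2 (secCard R n d) := by
    rw [Fintype.card_pi]
    push_cast
    rw [Real.logb_prod _ _ (fun d _ => by simpa using hne d)]
    simp only [Fintype.card_fin]
  have c3 : Real.logb 2 (∏ d, (secCard R n d : ℝ)) = ∑ d, Real.logb 2 (secCard R n d) :=
    Real.logb_prod _ _ (fun d _ => hne d)
  have c4 := Finset.sum_add_sum_compl S (fun d => Real.logb 2 (secCard R n d : ℝ))
  have c5 : n * ∑ d ∈ S, R d ≤ ∑ d ∈ S, Real.logb 2 (secCard R n d : ℝ) := by
    rw [Finset.mul_sum]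
    exact Finset.sum_le_sum fun d _ => le_log_secCard R n d
  have c6 : ∑ d, Real.logb 2 (secCard R n d : ℝ) ≤ n * ∑ d, R d + D := by
    calc _ ≤ ∑ d, (n * R d + 1) := Finset.sum_le_sum fun d _ => log_secCard_le R hR n d
      _ = _ := by
        rw [Finset.sum_add_distrib, ← Finset.mul_sum]
        simp
  have herr : 0 ≤ σ.err p Finset.univ (Set.mem_singleton _) := by
    unfold Strategy.err
    refine Finset.sum_nonneg fun ω _ => ?_
    split_ifs
    · exact hq.1 ω
    · exact le_rfl
  have c7 := mul_le_mul_of_nonneg_left c6 herr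
  rw [c1, c2] at hc
  have e2 : mutInf (iid p n) σ.Srv (fun ω => (σ.Mrv ω, XTn T n ω)) = σ.leak p T := rfl
  rw [e2] at hc
  have e3 : σ.unif p = Real.logb 2 (∏ d, (secCard R n d : ℝ)) - ent (iid p n) σ.Srv := rfl
  linarith

end Aux

/-- **Theorem 4 (Outer bound, all-or-nothing access structure).** Every
achievable rate tuple satisfies `R_S ≤ min_{T ⊊ ℒ} I(Y_S ; X_ℒ, Y_{Sᶜ} | X_T)`
for every `S ⊆ 𝒟`. -/
theorem outer_bound_all_or_nothing
    {L D : ℕ} (hL : 1 ≤ L) (hD : 1 ≤ D)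
    {𝒳 : Fin L → Type} {𝒴 : Fin D → Type}
    [∀ l, Fintype (𝒳 l)] [∀ l, Nonempty (𝒳 l)]
    [∀ d, Fintype (𝒴 d)] [∀ d, Nonempty (𝒴 d)]
    (p : Base 𝒳 𝒴 → ℝ) (hp : IsPMF p)
    (R : Fin D → ℝ)
    (hach : Achievable p {Finset.univ} {U : Finset (Fin L) | U ≠ Finset.univ} R) :
    ∀ S : Finset (Fin D), ∀ T : Finset (Fin L), T ≠ Finset.univ →
      ∑ d ∈ S, R d
        ≤ condMutInf p (YS S) (fun ω => (XT Finset.univ ω, YS Sᶜ ω)) (XT T) := by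
  obtain ⟨hR, σ, herr, hleak, hunif⟩ := hach
  intro S T hT
  have he := herr Finset.univ (Set.mem_singleton _)
  have hl := hleak T hT
  have hinv : Tendsto (fun n : ℕ => ((n : ℝ))⁻¹) atTop (nhds 0) :=
    tendsto_inv_atTop_zero.comp tendsto_natCast_atTop_atTop
  set I := condMutInf p (YS S) (fun ω => (XT Finset.univ ω, YS Sᶜ ω)) (XT T) with hI
  have hlim : Tendsto (fun n : ℕ => ((σ n).unif p + (σ n).leak p T + 1
      + (σ n).err p Finset.univ (Set.mem_singleton _) * D) * ((n : ℝ))⁻¹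
      + (σ n).err p Finset.univ (Set.mem_singleton _) * ∑ d, R d + I) atTop
      (nhds ((0 + 0 + 1 + 0 * (D : ℝ)) * 0 + 0 * ∑ d, R d + I)) :=
    (((((hunif.add hl).add tendsto_const_nhds).add (he.mul_const _)).mul hinv).add
      (he.mul_const _)).add tendsto_const_nhds
  have hlim' : ((0 + 0 + 1 + 0 * (D : ℝ)) * 0 + 0 * ∑ d, R d + I) = I := by ring
  rw [hlim'] at hlim
  refine ge_of_tendsto hlim ?_
  filter_upwards [eventually_gt_atTop 0] with n hn
  have hn' : (0:ℝ) < n := by exact_mod_cast hn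
  have hb := strategy_bound hp R hR n (σ n) S T
  rw [← hI] at hb
  refine le_of_mul_le_mul_left (hb.trans (le_of_eq ?_)) hn'
  field_simp
  ring

end SecretSharing
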